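/- Let (S_n) be a sequence of statistics with S_n sufficient for Θ with respect to F_n, and let (E_n) be a uniform asymptotic e-variable, i.e., limsup_{n→∞} sup_{θ∈Θ₀} E_θ[E_n] ≤ 1. If G_n := E_Θ[E_n | S_n], then (G_n) is also a uniform asymptotic e-variable, and for each n, every concave utility f, and every θ ∈ Θ: E_θ[f(G_n)] ≥ E_θ[f(E_n)] whenever both sides are defined, and E_θ[log(E_n/G_n)] ≤ 0. -/

import Mathlib

open MeasureTheory ENNReal Filter Set
open scoped Classical
noncomputable section

/-- The positive part of an extended real, as an extended nonnegative real. -/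
def erealPos (a : EReal) : ℝ≥0∞ := if a = ⊤ then ⊤ else ENNReal.ofReal a.toReal

/-- Generalized expectation `E[f] = E[f⁺] - E[f⁻]`, valued in the extended reals. -/
def eexp {Ω : Type*} {mΩ : MeasurableSpace Ω} (μ : Measure Ω) (f : Ω → EReal) : EReal :=
  ((∫⁻ ω, erealPos (f ω) ∂μ : ℝ≥0∞) : EReal) - ((∫⁻ ω, erealPos (-(f ω)) ∂μ : ℝ≥0∞) : EReal)

/-- The expectation of an extended-real random variable is (well-)defined when at least one of
the expectations of its positive and negative parts is finite. -/
def ExpDefined {Ω : Type*} {mΩ : MeasurableSpace Ω} (μ : Measure Ω) (f : Ω → EReal) : Prop :=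
  (∫⁻ ω, erealPos (f ω) ∂μ) < ⊤ ∨ (∫⁻ ω, erealPos (-(f ω)) ∂μ) < ⊤

/-- Logarithm on `[0,∞]`, with `log 0 = -∞` and `log ∞ = ∞`. -/
def elog (x : ℝ≥0∞) : EReal := if x = 0 then ⊥ else if x = ⊤ then ⊤ else ((Real.log x.toReal : ℝ) : EReal)

/-- Ratio on `[0,∞]` with the conventions `0/0 = 0` and `∞/∞ = 1`. -/
def eratio (a b : ℝ≥0∞) : ℝ≥0∞ := if a = ⊤ ∧ b = ⊤ then 1 else a / b

/-- `g` is a version of the conditional expectation of the nonnegative `h` given the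
sub-σ-field `m`, under the measure `μ`. -/
def IsCondExpNN {Ω : Type*} {mΩ : MeasurableSpace Ω} (m : MeasurableSpace Ω)
    (μ : @Measure Ω mΩ) (h g : Ω → ℝ≥0∞) : Prop :=
  Measurable[m] g ∧ ∀ A : Set Ω, MeasurableSet[m] A → ∫⁻ ω in A, g ω ∂μ = ∫⁻ ω in A, h ω ∂μ

/-- `g` is a universal (θ-free) version of the conditional expectation of `h` given `m`,
simultaneously under all measures `P θ`, `θ` ranging over a set `T` of parameters. -/
def IsUnivCondExpNN {Ω Θ : Type*} {mΩ : MeasurableSpace Ω} (m : MeasurableSpace Ω)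
    (P : Θ → @Measure Ω mΩ) (T : Set Θ) (h g : Ω → ℝ≥0∞) : Prop :=
  Measurable[m] g ∧ ∀ θ ∈ T, IsCondExpNN m (P θ) h g

/-- A sub-σ-field `m` is sufficient for the family `P` over the parameter set `T`:
every nonnegative measurable function admits a universal conditional expectation given `m`. -/
def IsSufficient {Ω Θ : Type*} {mΩ : MeasurableSpace Ω} (m : MeasurableSpace Ω)
    (P : Θ → @Measure Ω mΩ) (T : Set Θ) : Prop :=
  m ≤ mΩ ∧ ∀ h : Ω → ℝ≥0∞, Measurable[mΩ] h → ∃ g, IsUnivCondExpNN m P T h g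

/-- Kullback–Leibler divergence, valued in `[0,∞]` (as an extended real):
`∫ log(dμ/dν) dμ` when `μ ≪ ν`, and `+∞` otherwise. -/
def klDiv' {Ω : Type*} {mΩ : MeasurableSpace Ω} (μ ν : Measure Ω) : EReal :=
  if μ ≪ ν then eexp μ (fun ω => elog (μ.rnDeriv ν ω)) else ⊤

/-- `F : [0,∞] → [-∞,∞]` is the extension by limits of a concave utility `f : (0,∞) → ℝ`,
i.e. `F 0 = lim_{x↓0} f x`, `F ∞ = lim_{x→∞} f x`, and `F = f` in between. -/
def IsConcaveExtension (f : ℝ → ℝ) (F : ℝ≥0∞ → EReal) : Prop :=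
  ConcaveOn ℝ (Set.Ioi 0) f ∧
  (∀ x : ℝ≥0∞, x ≠ 0 → x ≠ ⊤ → F x = ((f x.toReal : ℝ) : EReal)) ∧
  Tendsto (fun x : ℝ => ((f x : ℝ) : EReal)) (nhdsWithin 0 (Set.Ioi 0)) (nhds (F 0)) ∧
  Tendsto (fun x : ℝ => ((f x : ℝ) : EReal)) atTop (nhds (F ⊤))

/-- right-derivative supergradient -/
def sgrad (f : ℝ → ℝ) (g : ℝ) : ℝ := -(derivWithin (-f) (Ioi g) g)

lemma measurable_sgrad (f : ℝ → ℝ) : Measurable (sgrad f) :=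
  (measurable_derivWithin_Ioi (-f)).neg

lemma sgrad_ineq {f : ℝ → ℝ} (hf : ConcaveOn ℝ (Ioi 0) f) {g x : ℝ} (hg : 0 < g) (hx : 0 < x) :
    f x ≤ f g + sgrad f g * (x - g) := by
  have hc : ConvexOn ℝ (Ioi 0) (-f) := hf.neg
  have hgi : g ∈ interior (Ioi (0:ℝ)) := by simpa using hg
  unfold sgrad
  rcases lt_trichotomy x g with h | h | h
  · have h1 := hc.slope_le_leftDeriv_of_mem_interior (x := x) (y := g) hx hgi h
    have h2 := h1.trans (hc.leftDeriv_le_rightDeriv_of_mem_interior hgi)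
    rw [slope_def_field, div_le_iff₀ (by linarith)] at h2
    simp only [Pi.neg_apply] at h2
    linarith
  · subst h; simp
  · have h2 := hc.rightDeriv_le_slope_of_mem_interior (x := g) (y := x) hgi hx h
    rw [slope_def_field, le_div_iff₀ (by linarith)] at h2
    simp only [Pi.neg_apply] at h2
    linarith

lemma measurable_erealPos : Measurable erealPos := by
  unfold erealPos
  exact Measurable.ite (measurableSet_singleton _) measurable_const
    (ENNReal.measurable_ofReal.comp measurable_ereal_toReal)

lemma measurable_F {f : ℝ → ℝ} {F : ℝ≥0∞ → EReal} (hF : IsConcaveExtension f F) :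
    Measurable F := by
  obtain ⟨hc, h1, -, -⟩ := hF
  have hcont : ContinuousOn f (Ioi 0) := by
    have := hc.continuousOn_interior
    rwa [interior_Ioi] at this
  have hm : Measurable ((Ioi (0:ℝ)).piecewise f 0) :=
    hcont.measurable_piecewise continuousOn_const measurableSet_Ioi
  have : F = fun x => if x = 0 then F 0 else if x = ⊤ then F ⊤ else
      (((Ioi (0:ℝ)).piecewise f 0 x.toReal : ℝ) : EReal) := by
    funext x
    split_ifs with h h'
    · rw [h]
    · rw [h']
    · rw [h1 x h h', Set.piecewise_eq_of_mem]
      exact ENNReal.toReal_pos h h'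
  rw [this]
  exact Measurable.ite (measurableSet_singleton _) measurable_const
    (Measurable.ite (measurableSet_singleton _) measurable_const
      ((hm.comp ENNReal.measurable_toReal).coe_real_ereal))

lemma F_le {f : ℝ → ℝ} {F : ℝ≥0∞ → EReal} (hF : IsConcaveExtension f F) {g : ℝ} (hg : 0 < g)
    {x : ℝ≥0∞} (hx : x ≠ ⊤) :
    F x ≤ ((f g + sgrad f g * (x.toReal - g) : ℝ) : EReal) := by
  obtain ⟨hc, h1, h0, -⟩ := hF
  by_cases h : x = 0
  · subst h
    have hlim : Tendsto (fun x : ℝ => ((f g + sgrad f g * (x - g) : ℝ) : EReal))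
        (nhdsWithin 0 (Set.Ioi 0)) (nhds ((f g + sgrad f g * (0 - g) : ℝ) : EReal)) := by
      apply Tendsto.mono_left _ nhdsWithin_le_nhds
      have : Continuous (fun x : ℝ => ((f g + sgrad f g * (x - g) : ℝ) : EReal)) :=
        continuous_coe_real_ereal.comp (by fun_prop)
      exact this.tendsto 0
    simp only [ENNReal.toReal_zero]
    refine le_of_tendsto_of_tendsto h0 hlim ?_
    filter_upwards [self_mem_nhdsWithin] with y hy
    exact EReal.coe_le_coe_iff.2 (sgrad_ineq hc hg hy)
  · rw [h1 x h hx]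
    exact EReal.coe_le_coe_iff.2 (sgrad_ineq hc hg (ENNReal.toReal_pos h hx))

lemma F_le_top {f : ℝ → ℝ} {F : ℝ≥0∞ → EReal} (hF : IsConcaveExtension f F)
    (hs : ∀ g, 0 < g → 0 ≤ sgrad f g) (x : ℝ≥0∞) : F x ≤ F ⊤ := by
  obtain ⟨hc, h1, h0, ht⟩ := hF
  have key : ∀ y : ℝ, 0 < y → ((f y : ℝ) : EReal) ≤ F ⊤ := by
    intro y hy
    refine ge_of_tendsto ht ?_
    filter_upwards [eventually_ge_atTop y] with z hz
    have := sgrad_ineq hc (hy.trans_le hz) hy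
    have h2 := hs z (hy.trans_le hz)
    refine EReal.coe_le_coe_iff.2 ?_
    nlinarith
  by_cases h : x = 0
  · subst h
    refine le_of_tendsto h0 ?_
    filter_upwards [self_mem_nhdsWithin] with y hy using key y hy
  · by_cases h' : x = ⊤
    · rw [h']
    · rw [h1 x h h']
      exact key _ (ENNReal.toReal_pos h h')

lemma F_top_bot {f : ℝ → ℝ} {F : ℝ≥0∞ → EReal} (hF : IsConcaveExtension f F)
    {g : ℝ} (hg : 0 < g) (hs : sgrad f g < 0) : F ⊤ = ⊥ := by
  obtain ⟨hc, h1, h0, ht⟩ := hF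
  refine tendsto_nhds_unique ht (EReal.tendsto_coe_nhds_bot_iff.2 ?_)
  have : Tendsto (fun x : ℝ => f g + sgrad f g * (x - g)) atTop atBot := by
    apply tendsto_atBot_add_const_left
    apply Tendsto.const_mul_atTop_of_neg hs
    exact tendsto_atTop_add_const_right _ _ tendsto_id
  refine tendsto_atBot_mono' _ ?_ this
  filter_upwards [eventually_gt_atTop 0] with x hx using sgrad_ineq hc hg hx

lemma erealPos_mono {a b : EReal} (h : a ≤ b) : erealPos a ≤ erealPos b := by
  unfold erealPos
  by_cases hb : b = ⊤
  · simp [hb]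
  · have ha : a ≠ ⊤ := fun h' => hb (by rw [h'] at h; exact top_le_iff.1 h)
    rw [if_neg hb, if_neg ha]
    by_cases ha' : a = ⊥
    · simp [ha']
    · exact ENNReal.ofReal_le_ofReal (EReal.toReal_le_toReal h ha' hb)

lemma erealPos_coe (r : ℝ) : erealPos (r : EReal) = ENNReal.ofReal r := by
  simp [erealPos]

lemma erealPos_neg_coe (r : ℝ) : erealPos (-(r : EReal)) = ENNReal.ofReal (-r) := by
  rw [← EReal.coe_neg, erealPos_coe]

lemma pointwise {a : EReal} {fg s g e : ℝ} (hg : 0 ≤ g) (he : 0 ≤ e)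
    (h : a ≤ ((fg + s * (e - g) : ℝ) : EReal)) :
    erealPos a + ENNReal.ofReal (-fg) +
      (ENNReal.ofReal s * ENNReal.ofReal g + ENNReal.ofReal (-s) * ENNReal.ofReal e) ≤
    ENNReal.ofReal fg + erealPos (-a) +
      (ENNReal.ofReal s * ENNReal.ofReal e + ENNReal.ofReal (-s) * ENNReal.ofReal g) := by
  induction a with
  | bot => simp [erealPos]
  | top => exact absurd (top_le_iff.1 h) (EReal.coe_ne_top _)
  | coe r =>
    rw [erealPos_coe, erealPos_neg_coe]
    have h' := EReal.coe_le_coe_iff.1 h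
    have e1 : ∀ t : ℝ, ENNReal.ofReal t = ENNReal.ofReal (max t 0) := by
      intro t; rw [ENNReal.ofReal_max]; simp
    have e2 : ∀ t : ℝ, max t 0 = max (-t) 0 + t := by
      intro t
      rcases le_total t 0 with h | h
      · rw [max_eq_right h, max_eq_left (by linarith)]; ring
      · rw [max_eq_left h, max_eq_right (by linarith)]; ring
    rw [e1 r, e1 (-r), e1 fg, e1 (-fg), e1 s, e1 (-s)]
    have p : ∀ t : ℝ, 0 ≤ max t 0 := fun t => le_max_right _ _
    have q1 := p r
    have q2 := p (-r)
    have q3 := p fg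
    have q4 := p (-fg)
    have q5 := p s
    have q6 := p (-s)
    rw [← ENNReal.ofReal_mul q5, ← ENNReal.ofReal_mul q6, ← ENNReal.ofReal_mul q5,
      ← ENNReal.ofReal_mul q6, ← ENNReal.ofReal_add q1 q4, ← ENNReal.ofReal_add q3 q2,
      ← ENNReal.ofReal_add (by positivity) (by positivity),
      ← ENNReal.ofReal_add (by positivity) (by positivity),
      ← ENNReal.ofReal_add (by positivity) (by positivity),
      ← ENNReal.ofReal_add (by positivity) (by positivity)]
    apply ENNReal.ofReal_le_ofReal
    rw [e2 r, e2 fg, e2 s]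
    nlinarith

section cond
variable {Ω : Type*} {m mΩ : MeasurableSpace Ω}

lemma weight_eq (hm : m ≤ mΩ) {μ : Measure Ω} {E G : Ω → ℝ≥0∞}
    (hE : Measurable E) (hG : Measurable G)
    (H : ∀ A : Set Ω, MeasurableSet[m] A → ∫⁻ ω in A, G ω ∂μ = ∫⁻ ω in A, E ω ∂μ)
    {w : Ω → ℝ≥0∞} (hw : Measurable[m] w) :
    ∫⁻ ω, w ω * G ω ∂μ = ∫⁻ ω, w ω * E ω ∂μ := by
  have h : (μ.withDensity G).trim hm = (μ.withDensity E).trim hm := by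
    refine @Measure.ext _ m _ _ fun A hA => ?_
    rw [trim_measurableSet_eq hm hA, trim_measurableSet_eq hm hA,
      withDensity_apply _ (hm _ hA), withDensity_apply _ (hm _ hA), H A hA]
  have h2 : ∫⁻ ω, w ω ∂(μ.withDensity G) = ∫⁻ ω, w ω ∂(μ.withDensity E) := by
    rw [← lintegral_trim hm hw, h, lintegral_trim hm hw]
  have hw' : Measurable w := hw.mono hm le_rfl
  rw [lintegral_withDensity_eq_lintegral_mul _ hG hw',
    lintegral_withDensity_eq_lintegral_mul _ hE hw'] at h2
  simpa [mul_comm] using h2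

lemma restrict_H (hm : m ≤ mΩ) {μ : Measure Ω} {E G : Ω → ℝ≥0∞}
    (H : ∀ A : Set Ω, MeasurableSet[m] A → ∫⁻ ω in A, G ω ∂μ = ∫⁻ ω in A, E ω ∂μ)
    {B : Set Ω} (hB : MeasurableSet[m] B) :
    ∀ A : Set Ω, MeasurableSet[m] A →
      ∫⁻ ω in A, G ω ∂(μ.restrict B) = ∫⁻ ω in A, E ω ∂(μ.restrict B) := by
  intro A hA
  rw [Measure.restrict_restrict (hm _ hA)]
  exact H _ (hA.inter hB)

/-- Jensen on a piece where `G` lies in `(0, N]` and the subgradient terms are bounded. -/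
lemma piece_mid (hm : m ≤ mΩ) {μ : Measure Ω} [IsFiniteMeasure μ]
    {E G : Ω → ℝ≥0∞}
    (hE : Measurable E) (hG : Measurable[m] G)
    (H : ∀ A : Set Ω, MeasurableSet[m] A → ∫⁻ ω in A, G ω ∂μ = ∫⁻ ω in A, E ω ∂μ)
    {f : ℝ → ℝ} {F : ℝ≥0∞ → EReal} (hF : IsConcaveExtension f F) (N : ℝ)
    (hN : ∀ᵐ ω ∂μ, G ω ≠ 0 ∧ G ω ≠ ⊤ ∧
      (G ω).toReal + |sgrad f (G ω).toReal| * (G ω).toReal ≤ N) :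
    ∫⁻ ω, (erealPos (F (E ω)) + erealPos (-(F (G ω)))) ∂μ ≤
      ∫⁻ ω, (erealPos (F (G ω)) + erealPos (-(F (E ω)))) ∂μ := by
  have hG' : Measurable G := hG.mono hm le_rfl
  have hFm := measurable_F hF
  set sp : Ω → ℝ≥0∞ := fun ω => ENNReal.ofReal (sgrad f (G ω).toReal) with hsp
  set sn : Ω → ℝ≥0∞ := fun ω => ENNReal.ofReal (-sgrad f (G ω).toReal) with hsn
  have hspm : Measurable[m] sp :=
    (ENNReal.measurable_ofReal.comp ((measurable_sgrad f).comp ENNReal.measurable_toReal)).comp hG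
  have hsnm : Measurable[m] sn :=
    (ENNReal.measurable_ofReal.comp
      ((measurable_sgrad f).neg.comp ENNReal.measurable_toReal)).comp hG
  have hspm' : Measurable sp := hspm.mono hm le_rfl
  have hsnm' : Measurable sn := hsnm.mono hm le_rfl
  have w1 := weight_eq hm hE hG' H hspm
  have w2 := weight_eq hm hE hG' H hsnm
  have bound : ∀ {u : Ω → ℝ≥0∞}, (∀ᵐ ω ∂μ, u ω ≤ ENNReal.ofReal N) → ∫⁻ ω, u ω ∂μ ≠ ⊤ := by
    intro u hu
    refine ((lintegral_mono_ae hu).trans_lt ?_).ne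
    rw [lintegral_const]
    exact ENNReal.mul_lt_top ENNReal.ofReal_lt_top (measure_lt_top _ _)
  have fG : ∫⁻ ω, G ω ∂μ ≠ ⊤ := by
    apply bound
    filter_upwards [hN] with ω ⟨_, h2, h3⟩
    rw [← ENNReal.ofReal_toReal h2]
    apply ENNReal.ofReal_le_ofReal
    have : 0 ≤ |sgrad f (G ω).toReal| * (G ω).toReal := by positivity
    linarith
  have fE : ∫⁻ ω, E ω ∂μ ≠ ⊤ := by
    have := H univ MeasurableSet.univ
    simp only [Measure.restrict_univ] at this
    rwa [← this]
  have f1 : ∫⁻ ω, sp ω * G ω ∂μ ≠ ⊤ := by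
    apply bound
    filter_upwards [hN] with ω ⟨_, h2, h3⟩
    simp only [hsp]
    nth_rw 2 [← ENNReal.ofReal_toReal h2]
    rw [← ENNReal.ofReal_mul' ENNReal.toReal_nonneg]
    apply ENNReal.ofReal_le_ofReal
    have h4 : 0 ≤ (G ω).toReal := ENNReal.toReal_nonneg
    have := mul_le_mul_of_nonneg_right (le_abs_self (sgrad f (G ω).toReal)) h4
    linarith
  have f2 : ∫⁻ ω, sn ω * G ω ∂μ ≠ ⊤ := by
    apply bound
    filter_upwards [hN] with ω ⟨_, h2, h3⟩
    simp only [hsn]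
    nth_rw 2 [← ENNReal.ofReal_toReal h2]
    rw [← ENNReal.ofReal_mul' ENNReal.toReal_nonneg]
    apply ENNReal.ofReal_le_ofReal
    have h4 : 0 ≤ (G ω).toReal := ENNReal.toReal_nonneg
    have := mul_le_mul_of_nonneg_right (neg_le_abs (sgrad f (G ω).toReal)) h4
    linarith
  have pw : ∀ᵐ ω ∂μ, erealPos (F (E ω)) + erealPos (-(F (G ω))) +
      (sp ω * G ω + sn ω * E ω) ≤ erealPos (F (G ω)) + erealPos (-(F (E ω))) +
      (sp ω * E ω + sn ω * G ω) := by
    filter_upwards [hN, ae_lt_top hE fE] with ω ⟨h1, h2, _⟩ h3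
    have hg := ENNReal.toReal_pos h1 h2
    have := pointwise hg.le (ENNReal.toReal_nonneg (a := E ω)) (F_le hF hg h3.ne)
    rw [ENNReal.ofReal_toReal h2, ENNReal.ofReal_toReal h3.ne] at this
    rw [hF.2.1 (G ω) h1 h2, erealPos_coe, erealPos_neg_coe]
    exact this
  have I := lintegral_mono_ae pw
  have a1 : Measurable (fun ω => sp ω * G ω) := hspm'.mul hG'
  have a2 : Measurable (fun ω => sp ω * E ω) := hspm'.mul hE
  have mGsum : Measurable (fun ω => sp ω * G ω + sn ω * E ω) :=
    (hspm'.mul hG').add (hsnm'.mul hE)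
  have mEsum : Measurable (fun ω => sp ω * E ω + sn ω * G ω) :=
    (hspm'.mul hE).add (hsnm'.mul hG')
  rw [lintegral_add_right _ mGsum, lintegral_add_right _ mEsum,
    lintegral_add_left a1, lintegral_add_left a2, ← w1, ← w2] at I
  exact (ENNReal.add_le_add_iff_right (ENNReal.add_ne_top.2 ⟨f1, f2⟩)).1 I

lemma piece_zero {μ : Measure Ω}
    {E G : Ω → ℝ≥0∞} (hE : Measurable E)
    (H : ∀ A : Set Ω, MeasurableSet[m] A → ∫⁻ ω in A, G ω ∂μ = ∫⁻ ω in A, E ω ∂μ)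
    (F : ℝ≥0∞ → EReal)
    (hN : ∀ᵐ ω ∂μ, G ω = 0) :
    ∫⁻ ω, (erealPos (F (E ω)) + erealPos (-(F (G ω)))) ∂μ ≤
      ∫⁻ ω, (erealPos (F (G ω)) + erealPos (-(F (E ω)))) ∂μ := by
  have h := H univ MeasurableSet.univ
  simp only [Measure.restrict_univ] at h
  rw [lintegral_congr_ae hN, lintegral_zero, eq_comm, lintegral_eq_zero_iff hE] at h
  refine lintegral_mono_ae ?_
  filter_upwards [hN, h] with ω h1 h2
  rw [h1, show E ω = 0 from h2]

lemma piece_top {μ : Measure Ω} [IsFiniteMeasure μ]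
    {E G : Ω → ℝ≥0∞} (hE : Measurable E)
    (H : ∀ A : Set Ω, MeasurableSet[m] A → ∫⁻ ω in A, G ω ∂μ = ∫⁻ ω in A, E ω ∂μ)
    {f : ℝ → ℝ} {F : ℝ≥0∞ → EReal} (hF : IsConcaveExtension f F)
    (hN : ∀ᵐ ω ∂μ, G ω = ⊤) :
    ∫⁻ ω, (erealPos (F (E ω)) + erealPos (-(F (G ω)))) ∂μ ≤
      ∫⁻ ω, (erealPos (F (G ω)) + erealPos (-(F (E ω)))) ∂μ := by
  by_cases hs : ∀ g, 0 < g → 0 ≤ sgrad f g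
  · refine lintegral_mono_ae ?_
    filter_upwards [hN] with ω h1
    rw [h1]
    have := F_le_top hF hs (E ω)
    exact add_le_add (erealPos_mono this) (erealPos_mono (EReal.neg_le_neg_iff.2 this))
  · push Not at hs
    obtain ⟨g, hg, hs⟩ := hs
    by_cases hμ : μ = 0
    · simp [hμ]
    have h := H univ MeasurableSet.univ
    simp only [Measure.restrict_univ] at h
    rw [lintegral_congr_ae hN, lintegral_const, ENNReal.top_mul (by simpa using hμ)] at h
    set c := f g - sgrad f g * g
    have pw : ∀ ω, ENNReal.ofReal (-sgrad f g) * E ω ≤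
        erealPos (-(F (E ω))) + ENNReal.ofReal c := by
      intro ω
      by_cases hω : E ω = ⊤
      · rw [hω, F_top_bot hF hg hs]; simp [erealPos]
      · have := EReal.neg_le_neg_iff.2 (F_le hF hg hω)
        have := erealPos_mono this
        rw [erealPos_neg_coe] at this
        refine le_trans ?_ (add_le_add_left this _)
        refine le_trans ?_ ENNReal.ofReal_add_le
        nth_rw 1 [← ENNReal.ofReal_toReal hω]
        rw [← ENNReal.ofReal_mul (by linarith)]
        apply ENNReal.ofReal_le_ofReal
        simp only [c]
        linarith
    have I := lintegral_mono (μ := μ) pw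
    rw [lintegral_const_mul _ hE, ← h, ENNReal.mul_top (by simpa using hs),
      lintegral_add_right _ measurable_const, lintegral_const, top_le_iff,
      ENNReal.add_eq_top] at I
    have I' : ∫⁻ ω, erealPos (-(F (E ω))) ∂μ = ⊤ := by
      rcases I with I | I
      · exact I
      · exact absurd I (ENNReal.mul_lt_top ENNReal.ofReal_lt_top (measure_lt_top _ _)).ne
    have : (⊤ : ℝ≥0∞) ≤ ∫⁻ ω, (erealPos (F (G ω)) + erealPos (-(F (E ω)))) ∂μ := by
      rw [← I']
      exact lintegral_mono fun ω => le_add_self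
    exact le_top.trans this

def kap (f : ℝ → ℝ) (g : ℝ≥0∞) : ℕ :=
  if g = 0 then 0 else if g = ⊤ then 1 else
    2 + ⌈g.toReal + |sgrad f g.toReal| * g.toReal⌉₊

lemma measurable_kap (f : ℝ → ℝ) : Measurable (kap f) := by
  unfold kap
  refine Measurable.ite (measurableSet_singleton _) measurable_const
    (Measurable.ite (measurableSet_singleton _) measurable_const
      (measurable_const.add (Nat.measurable_ceil.comp ?_)))
  have h : Measurable fun g : ℝ≥0∞ => sgrad f g.toReal :=
    (measurable_sgrad f).comp ENNReal.measurable_toReal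
  exact ENNReal.measurable_toReal.add (h.abs.mul ENNReal.measurable_toReal)

lemma jensen_J (hm : m ≤ mΩ) {μ : Measure Ω} [IsFiniteMeasure μ]
    {E G : Ω → ℝ≥0∞}
    (hE : Measurable E) (hG : Measurable[m] G)
    (H : ∀ A : Set Ω, MeasurableSet[m] A → ∫⁻ ω in A, G ω ∂μ = ∫⁻ ω in A, E ω ∂μ)
    {f : ℝ → ℝ} {F : ℝ≥0∞ → EReal} (hF : IsConcaveExtension f F) :
    ∫⁻ ω, (erealPos (F (E ω)) + erealPos (-(F (G ω)))) ∂μ ≤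
      ∫⁻ ω, (erealPos (F (G ω)) + erealPos (-(F (E ω)))) ∂μ := by
  set B : ℕ → Set Ω := fun n => (fun ω => kap f (G ω)) ⁻¹' {n} with hB
  have hBm : ∀ n, MeasurableSet[m] (B n) := fun n =>
    ((measurable_kap f).comp hG) (measurableSet_singleton n)
  have hBm' : ∀ n, MeasurableSet (B n) := fun n => hm _ (hBm n)
  have hU : ⋃ n, B n = univ := by
    ext ω; simp [hB]
  have hd : Pairwise (Function.onFun Disjoint B) := by
    intro i j hij
    rw [Function.onFun, Set.disjoint_left]
    intro ω h1 h2
    exact hij (h1.symm.trans h2)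
  rw [← setLIntegral_univ, ← setLIntegral_univ (f := fun ω => erealPos (F (G ω)) + _), ← hU,
    lintegral_iUnion hBm' hd, lintegral_iUnion hBm' hd]
  refine ENNReal.tsum_le_tsum fun n => ?_
  have Hn := restrict_H hm H (hBm n)
  have hmem : ∀ᵐ ω ∂(μ.restrict (B n)), kap f (G ω) = n := ae_restrict_mem (hBm' n)
  rcases n with _ | _ | n
  · refine piece_zero hE Hn F ?_
    filter_upwards [hmem] with ω h
    unfold kap at h
    split_ifs at h with h1 h2
    · exact h1
    · omega
  · refine piece_top hE Hn hF ?_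
    filter_upwards [hmem] with ω h
    unfold kap at h
    split_ifs at h with h1 h2
    · exact h2
    · omega
  · refine piece_mid hm hE hG Hn hF n ?_
    filter_upwards [hmem] with ω h
    unfold kap at h
    split_ifs at h with h1 h2
    · omega
    · refine ⟨h1, h2, ?_⟩
      exact (Nat.le_ceil _).trans (by exact_mod_cast (by omega))

lemma eexp_jensen (hm : m ≤ mΩ) {μ : Measure Ω} [IsFiniteMeasure μ]
    {E G : Ω → ℝ≥0∞}
    (hE : Measurable E) (hG : Measurable[m] G)
    (H : ∀ A : Set Ω, MeasurableSet[m] A → ∫⁻ ω in A, G ω ∂μ = ∫⁻ ω in A, E ω ∂μ)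
    {f : ℝ → ℝ} {F : ℝ≥0∞ → EReal} (hF : IsConcaveExtension f F)
    (hdG : ExpDefined μ (fun ω => F (G ω))) :
    eexp μ (fun ω => F (E ω)) ≤ eexp μ (fun ω => F (G ω)) := by
  have J := jensen_J hm hE hG H hF
  have hFm := measurable_F hF
  have hG' : Measurable G := hG.mono hm le_rfl
  have m1 : Measurable fun ω => erealPos (F (E ω)) := measurable_erealPos.comp (hFm.comp hE)
  have m2 : Measurable fun ω => erealPos (F (G ω)) := measurable_erealPos.comp (hFm.comp hG')
  rw [lintegral_add_left m1, lintegral_add_left m2] at J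
  unfold ExpDefined at hdG
  unfold eexp
  generalize (∫⁻ ω, erealPos (F (E ω)) ∂μ) = pe at *
  generalize (∫⁻ ω, erealPos (F (G ω)) ∂μ) = pg at *
  generalize (∫⁻ ω, erealPos (-F (E ω)) ∂μ) = ne at *
  generalize (∫⁻ ω, erealPos (-F (G ω)) ∂μ) = ng at *
  by_cases h1 : ne = ⊤
  · simp [h1]
  by_cases h2 : pg = ⊤
  · have h3 : ng ≠ ⊤ := by
      rcases hdG with h | h
      · exact absurd h2 h.ne
      · exact h.ne
    lift ng to NNReal using h3
    rw [h2]
    have : ((⊤ : ℝ≥0∞) : EReal) - (((ng : NNReal) : ℝ≥0∞) : EReal) = ⊤ := by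
      rw [EReal.coe_ennreal_top]
      exact EReal.top_sub_coe (ng : ℝ)
    rw [this]; exact le_top
  · have h3 : pe + ng ≠ ⊤ := (J.trans_lt (ENNReal.add_lt_top.2
      ⟨lt_top_iff_ne_top.2 h2, lt_top_iff_ne_top.2 h1⟩)).ne
    obtain ⟨h4, h5⟩ := ENNReal.add_ne_top.1 h3
    lift ng to NNReal using h5
    lift pe to NNReal using h4
    lift ne to NNReal using h1
    lift pg to NNReal using h2
    have J' : (pe : ℝ) + ng ≤ pg + ne := by exact_mod_cast J
    have : (((pe : ℝ) - ne : ℝ) : EReal) ≤ (((pg : ℝ) - ng : ℝ) : EReal) :=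
      EReal.coe_le_coe_iff.2 (by linarith)
    rw [EReal.coe_sub, EReal.coe_sub] at this
    exact this

lemma ratio_le (hm : m ≤ mΩ) {μ : Measure Ω} [IsProbabilityMeasure μ]
    {E G : Ω → ℝ≥0∞}
    (hE : Measurable E) (hG : Measurable[m] G)
    (H : ∀ A : Set Ω, MeasurableSet[m] A → ∫⁻ ω in A, G ω ∂μ = ∫⁻ ω in A, E ω ∂μ) :
    ∫⁻ ω, eratio (E ω) (G ω) ∂μ ≤ 1 := by
  have hG' : Measurable G := hG.mono hm le_rfl
  -- weight `1/G` off `{G = 0}`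
  set w : Ω → ℝ≥0∞ := fun ω => if G ω = 0 then 0 else (G ω)⁻¹ with hw
  have hwm : Measurable[m] w := by
    have : Measurable (fun x : ℝ≥0∞ => if x = 0 then 0 else x⁻¹) :=
      Measurable.ite (measurableSet_singleton _) measurable_const measurable_inv
    exact this.comp hG
  have W := weight_eq hm hE hG' H hwm
  have hz : ∀ᵐ ω ∂μ, G ω = 0 → E ω = 0 := by
    have hA : MeasurableSet[m] (G ⁻¹' {0}) := hG (measurableSet_singleton 0)
    have h := H _ hA
    rw [setLIntegral_congr_fun (g := fun _ => 0) (hm _ hA) (fun ω hω => hω), lintegral_zero,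
      eq_comm, lintegral_eq_zero_iff hE] at h
    exact (ae_restrict_iff' (hm _ hA)).1 h
  set T : Set Ω := G ⁻¹' {⊤} with hT
  have hTm : MeasurableSet T := hG' (measurableSet_singleton ⊤)
  calc ∫⁻ ω, eratio (E ω) (G ω) ∂μ
      ≤ ∫⁻ ω, (w ω * E ω + T.indicator 1 ω) ∂μ := by
        refine lintegral_mono_ae ?_
        filter_upwards [hz] with ω h
        unfold eratio
        by_cases h1 : G ω = ⊤
        · have : T.indicator (1 : Ω → ℝ≥0∞) ω = 1 := Set.indicator_of_mem (s := T) (a := ω) h1 _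
          rw [this]
          by_cases h2 : E ω = ⊤
          · simp [h1, h2]
          · simp [h1, h2]
        · by_cases h0 : G ω = 0
          · simp [h0, h h0]
          · simp only [h1, and_false, if_false, hw, h0]
            rw [ENNReal.div_eq_inv_mul]
            exact le_self_add
    _ = ∫⁻ ω, (w ω * G ω + T.indicator 1 ω) ∂μ := by
        rw [lintegral_add_right _ (measurable_one.indicator hTm),
          lintegral_add_right _ (measurable_one.indicator hTm), W]
    _ ≤ ∫⁻ _, 1 ∂μ := by
        refine lintegral_mono fun ω => ?_
        by_cases h1 : G ω = ⊤
        · have : T.indicator (1 : Ω → ℝ≥0∞) ω = 1 := Set.indicator_of_mem (s := T) (a := ω) h1 _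
          simp [this, hw, h1]
        · have : T.indicator (1 : Ω → ℝ≥0∞) ω = 0 := Set.indicator_of_notMem (s := T) (a := ω) h1 _
          by_cases h0 : G ω = 0
          · simp [this, h0]
          · simp [this, hw, h0, ENNReal.inv_mul_cancel h0 h1]
    _ = 1 := by simp

lemma elog_pw (x : ℝ≥0∞) : erealPos (elog x) + 1 ≤ erealPos (-(elog x)) + x := by
  unfold elog
  split_ifs with h h'
  · simp [erealPos]
  · simp [h']
  · rw [erealPos_coe, erealPos_neg_coe]
    have hx := ENNReal.toReal_pos h h'
    nth_rw 3 [← ENNReal.ofReal_toReal h']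
    have hl := Real.log_le_sub_one_of_pos hx
    rcases le_total 0 (Real.log x.toReal) with h0 | h0
    · rw [ENNReal.ofReal_of_nonpos (p := -_) (by linarith), zero_add, ← ENNReal.ofReal_one,
        ← ENNReal.ofReal_add h0 zero_le_one]
      exact ENNReal.ofReal_le_ofReal (by linarith)
    · rw [ENNReal.ofReal_of_nonpos h0, zero_add, ← ENNReal.ofReal_one,
        ← ENNReal.ofReal_add (by linarith) hx.le]
      exact ENNReal.ofReal_le_ofReal (by linarith)

lemma elog_ratio (hm : m ≤ mΩ) {μ : Measure Ω} [IsProbabilityMeasure μ]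
    {E G : Ω → ℝ≥0∞}
    (hE : Measurable E) (hG : Measurable[m] G)
    (H : ∀ A : Set Ω, MeasurableSet[m] A → ∫⁻ ω in A, G ω ∂μ = ∫⁻ ω in A, E ω ∂μ) :
    eexp μ (fun ω => elog (eratio (E ω) (G ω))) ≤ 0 := by
  have hG' : Measurable G := hG.mono hm le_rfl
  have R := ratio_le hm hE hG H
  have hr : Measurable fun ω => eratio (E ω) (G ω) := by
    unfold eratio
    exact Measurable.ite ((hE (measurableSet_singleton ⊤)).inter
      (hG' (measurableSet_singleton ⊤))) measurable_const (hE.div hG')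
  have I := lintegral_mono (μ := μ) (fun ω => elog_pw (eratio (E ω) (G ω)))
  rw [lintegral_add_right _ measurable_const, lintegral_add_right _ hr] at I
  simp only [lintegral_const, measure_univ, mul_one] at I
  have J := (ENNReal.add_le_add_iff_right ENNReal.one_ne_top).1
    (I.trans (add_le_add_right R _))
  unfold eexp
  exact EReal.sub_nonpos.2 (EReal.coe_ennreal_le_coe_ennreal_iff.2 J)

end cond

/-- Rao–Blackwellization of uniform asymptotic e-variables: if `S n` (encoded as the
sub-σ-field `m n ⊆ 𝓕 n`) is sufficient for `Θ` in the `𝓕 n`-experiment,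
`(E n)` is a uniform asymptotic e-variable (`limsup_n sup_{θ∈Θ₀} E_θ[E n] ≤ 1`), and
`G n := E_Θ[E n | S n]`, then `(G n)` is also a uniform asymptotic e-variable; moreover for
each `n`, every concave utility `F`, and every `θ ∈ Θ`: `E_θ[F(G n)] ≥ E_θ[F(E n)]`
whenever both sides are defined, and `E_θ[log(E n / G n)] ≤ 0`. -/
theorem rao_blackwell_stmt18
    {Ω Θ : Type*} {mΩ : MeasurableSpace Ω} (P : Θ → Measure Ω)
    [∀ θ, IsProbabilityMeasure (P θ)]
    (Θ₀ Θ₁ : Set Θ) (hΘ : Θ₀ ∪ Θ₁ = Set.univ)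
    (𝓕 : Filtration ℕ mΩ)
    (m : ℕ → MeasurableSpace Ω) (hm : ∀ k, m k ≤ 𝓕 k)
    -- `m n = σ(S n)` is sufficient for `Θ` in the `𝓕 n`-experiment
    (hsuf : ∀ k, ∀ h : Ω → ℝ≥0∞, Measurable[𝓕 k] h →
      ∃ g, Measurable[m k] g ∧ ∀ θ : Θ, ∀ A : Set Ω, MeasurableSet[m k] A →
        ∫⁻ ω in A, g ω ∂(P θ) = ∫⁻ ω in A, h ω ∂(P θ))
    (E : ℕ → Ω → ℝ≥0∞) (hEadp : ∀ k, Measurable[𝓕 k] (E k))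
    -- `(E n)` is a uniform asymptotic e-variable
    (hE : Filter.limsup (fun k => ⨆ θ ∈ Θ₀, ∫⁻ ω, E k ω ∂(P θ)) Filter.atTop ≤ 1)
    -- `G n` is the universal conditional expectation `E_Θ[E n | S n]`
    (G : ℕ → Ω → ℝ≥0∞)
    (hG : ∀ k, Measurable[m k] (G k) ∧ ∀ θ : Θ, ∀ A : Set Ω, MeasurableSet[m k] A →
      ∫⁻ ω in A, G k ω ∂(P θ) = ∫⁻ ω in A, E k ω ∂(P θ))
    (f : ℝ → ℝ) (F : ℝ≥0∞ → EReal) (hF : IsConcaveExtension f F) :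
    Filter.limsup (fun k => ⨆ θ ∈ Θ₀, ∫⁻ ω, G k ω ∂(P θ)) Filter.atTop ≤ 1 ∧
    (∀ k : ℕ, ∀ θ : Θ,
      (ExpDefined (P θ) (fun ω => F (E k ω)) → ExpDefined (P θ) (fun ω => F (G k ω)) →
        eexp (P θ) (fun ω => F (E k ω)) ≤ eexp (P θ) (fun ω => F (G k ω))) ∧
      eexp (P θ) (fun ω => elog (eratio (E k ω) (G k ω))) ≤ 0) := by
  have hm' : ∀ k, m k ≤ mΩ := fun k => (hm k).trans (𝓕.le k)
  have hE' : ∀ k, Measurable (E k) := fun k => (hEadp k).mono (𝓕.le k) le_rfl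
  refine ⟨?_, fun k θ => ⟨fun _ h2 => ?_, ?_⟩⟩
  · have : ∀ k θ, ∫⁻ ω, G k ω ∂(P θ) = ∫⁻ ω, E k ω ∂(P θ) := by
      intro k θ
      simpa using (hG k).2 θ univ MeasurableSet.univ
    simpa only [this] using hE
  · exact eexp_jensen (hm' k) (hE' k) (hG k).1 ((hG k).2 θ) hF h2
  · exact elog_ratio (hm' k) (hE' k) (hG k).1 ((hG k).2 θ)
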